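/- Let ϑ_P be a primitive recognisable random substitution of constant length ℓ over an alphabet A. If there exists N ∈ N such that #ϑ(a) = N for all a ∈ A, then the topological entropy of the random substitution subshift is h_top(X_ϑ) = (ℓ − 1)^{-1} log N. Moreover, the frequency measure μ corresponding to uniform probabilities (P[ϑ_P(a) = s] = 1/N for all a ∈ A and s ∈ ϑ(a)) is a measure of maximal entropy for X_ϑ. -/

import Mathlib

open Filter MeasureTheory

namespace RandomSubstitutionTheory

variable {A : Type*} [Fintype A] [DecidableEq A]

/-- The set of realisations of `ϑ(u)` for a word `u`. -/
def reals (θ : A → Finset (List A)) : List A → Finset (List A)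
  | [] => {[]}
  | a :: u => (θ a).biUnion fun v => (reals θ u).image fun w => v ++ w

/-- The set of realisations of `ϑ^n(u)` for a word `u`. -/
def realsIter (θ : A → Finset (List A)) : ℕ → List A → Finset (List A)
  | 0, u => {u}
  | n + 1, u => (reals θ u).biUnion fun v => realsIter θ n v

/-- `wordProb θ P u w` is the probability `P[ϑ_P(u) = w]`, each letter of `u` being
substituted independently. -/
noncomputable def wordProb (θ : A → Finset (List A)) (P : A → List A → ℝ) :
    List A → List A → ℝ
  | [], w => if w = [] then 1 else 0
  | a :: u, w =>
      ∑ v ∈ θ a, P a v * (if v <+: w then wordProb θ P u (w.drop v.length) else 0)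

/-- `iterProb θ P n u w` is the probability `P[ϑ_P^n(u) = w]` of the induced Markov chain. -/
noncomputable def iterProb (θ : A → Finset (List A)) (P : A → List A → ℝ) :
    ℕ → List A → List A → ℝ
  | 0, u, w => if u = w then 1 else 0
  | n + 1, u, w => ∑ v ∈ reals θ u, wordProb θ P u v * iterProb θ P n v w

/-- The substitution matrix `M_{ij} = E[|ϑ_P(a_j)|_{a_i}]`. -/
noncomputable def substM (θ : A → Finset (List A)) (P : A → List A → ℝ) :
    Matrix A A ℝ :=
  Matrix.of fun i j => ∑ w ∈ θ j, P j w * (w.count i : ℝ)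

/-- The defining data of a random substitution: nonempty finite sets of nonempty words
and strictly positive probability vectors. -/
def IsRandomSubstitution (θ : A → Finset (List A)) (P : A → List A → ℝ) : Prop :=
  (∀ a, (θ a).Nonempty) ∧ (∀ a, ∀ w ∈ θ a, w ≠ []) ∧
    (∀ a, ∀ w ∈ θ a, 0 < P a w) ∧ (∀ a w, w ∉ θ a → P a w = 0) ∧
    ∀ a, ∑ w ∈ θ a, P a w = 1

/-- Primitivity of the substitution matrix: some power has strictly positive entries. -/
def IsPrimitive (θ : A → Finset (List A)) (P : A → List A → ℝ) : Prop :=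
  ∃ k : ℕ, ∀ i j : A, 0 < (substM θ P ^ k) i j

/-- The Perron–Frobenius eigenvalue is `> 1` (witnessed by a positive right eigenvector). -/
def IsExpanding (θ : A → Finset (List A)) (P : A → List A → ℝ) : Prop :=
  ∃ lam : ℝ, 1 < lam ∧ ∃ R : A → ℝ, (∀ a, 0 < R a) ∧ (substM θ P).mulVec R = lam • R

/-- A word is legal if it occurs as a subword of some level-`k` inflation word. -/
def Legal (θ : A → Finset (List A)) (u : List A) : Prop :=
  ∃ (a : A) (k : ℕ) (w : List A), w ∈ realsIter θ k [a] ∧ u <:+: w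

/-- All words of length `n` over the alphabet. -/
def allWords (A : Type*) [Fintype A] [DecidableEq A] (n : ℕ) : Finset (List A) :=
  (Finset.univ : Finset (Fin n → A)).image List.ofFn

/-- All legal words of length `n`. -/
noncomputable def legalWords (θ : A → Finset (List A)) (n : ℕ) : Finset (List A) :=
  letI := Classical.decPred (Legal θ)
  (allWords A n).filter (Legal θ)

/-- The left shift on bi-infinite sequences. -/
def shift : (ℤ → A) → ℤ → A := fun x i => x (i + 1)

/-- The finite word of length `n` read off a bi-infinite sequence starting at position `m`. -/
def window (x : ℤ → A) (m : ℤ) (n : ℕ) : List A :=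
  (List.range n).map fun t => x (m + (t : ℤ))

/-- The random substitution subshift `X_ϑ`. -/
def Xtheta (θ : A → Finset (List A)) : Set (ℤ → A) :=
  {x | ∀ (m : ℤ) (n : ℕ), Legal θ (window x m n)}

/-- The cylinder set of the word `v` at position `m`. -/
def cylinder (v : List A) (m : ℤ) : Set (ℤ → A) :=
  {x | window x m v.length = v}

/-- The number `|w|_v` of (possibly overlapping) occurrences of `v` in `w`. -/
def occCount (v w : List A) : ℕ :=
  ((List.range w.length).filter fun i => decide (v <+: w.drop i)).length

/-- Expected length `E[|ϑ_P^k(a)|]`. -/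
noncomputable def expLen (θ : A → Finset (List A)) (P : A → List A → ℝ)
    (k : ℕ) (a : A) : ℝ :=
  ∑ w ∈ realsIter θ k [a], iterProb θ P k [a] w * (w.length : ℝ)

/-- Expected number of occurrences `E[|ϑ_P^k(a)|_v]`. -/
noncomputable def expCount (θ : A → Finset (List A)) (P : A → List A → ℝ)
    (k : ℕ) (a : A) (v : List A) : ℝ :=
  ∑ w ∈ realsIter θ k [a], iterProb θ P k [a] w * (occCount v w : ℝ)

/-- `μ` is the frequency measure of `(ϑ, P)`: a shift-invariant Borel probability measure
supported on `X_ϑ` whose cylinder values are the expected word frequencies. -/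
def IsFrequencyMeasure [MeasurableSpace A] (θ : A → Finset (List A))
    (P : A → List A → ℝ) (μ : Measure (ℤ → A)) : Prop :=
  IsProbabilityMeasure μ ∧
    (∀ s : Set (ℤ → A), MeasurableSet s → μ (shift ⁻¹' s) = μ s) ∧
    μ (Xtheta θ) = 1 ∧
    ∀ v : List A, Legal θ v → ∀ (m : ℤ) (a : A),
      Tendsto (fun k : ℕ => expCount θ P k a v / expLen θ P k a) atTop
        (nhds ((μ (cylinder v m)).toReal))

/-- The `n`-th entropy sum `∑_{u ∈ L_ϑ^n} -μ[u] log μ[u]`. -/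
noncomputable def entropySeq [MeasurableSpace A] (θ : A → Finset (List A))
    (μ : Measure (ℤ → A)) (n : ℕ) : ℝ :=
  ∑ u ∈ legalWords θ n, Real.negMulLog ((μ (cylinder u 0)).toReal)

/-- The measure-theoretic (Kolmogorov–Sinai) entropy of the shift with respect to `μ`,
computed along cylinder partitions. -/
noncomputable def measEntropy [MeasurableSpace A] (θ : A → Finset (List A))
    (μ : Measure (ℤ → A)) : ℝ :=
  limsup (fun n : ℕ => entropySeq θ μ n / (n : ℝ)) atTop

/-- The topological entropy of the subshift `X_ϑ`. -/
noncomputable def topEntropy (θ : A → Finset (List A)) : ℝ :=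
  limsup (fun n : ℕ => Real.log ((legalWords θ n).card) / (n : ℝ)) atTop

/-- The entropy vector `H_{k,a} = H(ϑ_P^k(a))`. -/
noncomputable def Hvec (θ : A → Finset (List A)) (P : A → List A → ℝ)
    (k : ℕ) (a : A) : ℝ :=
  ∑ w ∈ realsIter θ k [a], Real.negMulLog (iterProb θ P k [a] w)

/-- The inner product `H_k^T R`. -/
noncomputable def HdotR (θ : A → Finset (List A)) (P : A → List A → ℝ)
    (R : A → ℝ) (k : ℕ) : ℝ :=
  ∑ a, Hvec θ P k a * R a

/-- Binary entropy `H(p) = -p log p - (1-p) log (1-p)`. -/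
noncomputable def binEnt (p : ℝ) : ℝ := Real.negMulLog p + Real.negMulLog (1 - p)

/-- Unique realisation paths: concatenation of level-`k` inflation words of the letters of a
legal word is injective. -/
def UniqueRealisationPaths (θ : A → Finset (List A)) : Prop :=
  ∀ v : List A, Legal θ v → ∀ k : ℕ, ∀ f g : Fin v.length → List A,
    (∀ i, f i ∈ realsIter θ k [v.get i]) → (∀ i, g i ∈ realsIter θ k [v.get i]) →
      (List.ofFn f).flatten = (List.ofFn g).flatten → f = g

/-- The disjoint set condition. -/
def DisjointSetCondition (θ : A → Finset (List A)) : Prop :=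
  ∀ (a : A) (k : ℕ), ∀ u ∈ θ a, ∀ v ∈ θ a, u ≠ v →
    ∀ w, w ∈ realsIter θ k u → w ∉ realsIter θ k v

/-- The identical set condition. -/
def IdenticalSetCondition (θ : A → Finset (List A)) : Prop :=
  ∀ (a : A) (k : ℕ), ∀ u ∈ θ a, ∀ v ∈ θ a, realsIter θ k u = realsIter θ k v

/-- Identical production probabilities. -/
def IdenticalProductionProbabilities (θ : A → Finset (List A))
    (P : A → List A → ℝ) : Prop :=
  ∀ a : A, ∀ u ∈ θ a, ∀ v ∈ θ a, ∀ (k : ℕ) (w : List A),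
    iterProb θ P k u w = iterProb θ P k v w

/-- The disjoint set condition for the `k`-th power `ϑ^k`. -/
def DisjointSetConditionPow (θ : A → Finset (List A)) (k : ℕ) : Prop :=
  ∀ (a : A) (j : ℕ), ∀ u ∈ realsIter θ k [a], ∀ v ∈ realsIter θ k [a], u ≠ v →
    ∀ w, w ∈ realsIter θ (k * j) u → w ∉ realsIter θ (k * j) v

/-- The identical set condition for the `k`-th power `ϑ^k`. -/
def IdenticalSetConditionPow (θ : A → Finset (List A)) (k : ℕ) : Prop :=
  ∀ (a : A) (j : ℕ), ∀ u ∈ realsIter θ k [a], ∀ v ∈ realsIter θ k [a],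
    realsIter θ (k * j) u = realsIter θ (k * j) v

/-- Identical production probabilities for the `k`-th power `ϑ^k`. -/
def IdenticalProductionProbabilitiesPow (θ : A → Finset (List A))
    (P : A → List A → ℝ) (k : ℕ) : Prop :=
  ∀ a : A, ∀ u ∈ realsIter θ k [a], ∀ v ∈ realsIter θ k [a], ∀ (j : ℕ) (w : List A),
    iterProb θ P (k * j) u w = iterProb θ P (k * j) v w

/-- Compatibility: all realisations of a letter have the same abelianisation. -/
def Compatible (θ : A → Finset (List A)) : Prop :=
  ∀ a : A, ∀ u ∈ θ a, ∀ v ∈ θ a, ∀ b : A, u.count b = v.count b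

/-- Constant length `ℓ ≥ 2`. -/
def ConstantLength (θ : A → Finset (List A)) (ℓ : ℕ) : Prop :=
  2 ≤ ℓ ∧ ∀ a : A, ∀ w ∈ θ a, w.length = ℓ

/-- The set `ϑ(y)` of bi-infinite sequences obtained by substituting each letter of `y`,
with the image of `y 0` beginning at position `0`. -/
def substSeq (θ : A → Finset (List A)) (y : ℤ → A) : Set (ℤ → A) :=
  {x | ∃ v : ℤ → List A, (∀ j, v j ∈ θ (y j)) ∧
    ∃ p : ℤ → ℤ, p 0 = 0 ∧ (∀ j, p (j + 1) = p j + (v j).length) ∧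
      ∀ (j : ℤ) (t : ℕ) (ht : t < (v j).length), x (p j + (t : ℤ)) = (v j).get ⟨t, ht⟩}

/-- `ϑ(X)` for a set of bi-infinite sequences. -/
def substImage (θ : A → Finset (List A)) (X : Set (ℤ → A)) : Set (ℤ → A) :=
  ⋃ y ∈ X, substSeq θ y

/-- The set `ϑ^m(y)` of bi-infinite sequences. -/
def substSeqPow (θ : A → Finset (List A)) : ℕ → (ℤ → A) → Set (ℤ → A)
  | 0, y => {y}
  | m + 1, y => ⋃ z ∈ substSeq θ y, substSeqPow θ m z

/-- The maximal length of an inflation word of the letter `a` (equals the common length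
when lengths are well-defined). -/
def maxLen (θ : A → Finset (List A)) (a : A) : ℕ := (θ a).sup List.length

/-- Recognisability: every `x ∈ X_ϑ` has a unique inflation-word decomposition. -/
def Recognisable (θ : A → Finset (List A)) : Prop :=
  ∀ x ∈ Xtheta θ, ∃! p : (ℤ → A) × ℕ,
    p.1 ∈ Xtheta θ ∧ p.2 < maxLen θ (p.1 0) ∧
      (fun i => x (i - (p.2 : ℤ))) ∈ substSeq θ p.1

/-- Recognisability of the `m`-th power of a constant length-`ℓ` substitution. -/
def RecognisablePow (θ : A → Finset (List A)) (m ℓ : ℕ) : Prop :=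
  ∀ x ∈ Xtheta θ, ∃! p : (ℤ → A) × ℕ,
    p.1 ∈ Xtheta θ ∧ p.2 < ℓ ^ m ∧
      (fun i => x (i - (p.2 : ℤ))) ∈ substSeqPow θ m p.1

/-- The set `ϑ^m([a])` of exact images of sequences in the cylinder `[a] ⊆ X_ϑ`. -/
def inflCylPow (θ : A → Finset (List A)) (m : ℕ) (a : A) : Set (ℤ → A) :=
  ⋃ y ∈ {w ∈ Xtheta θ | w 0 = a}, substSeqPow θ m y

/-- `r` is a radius of local recognisability for `ϑ^m`. -/
def RecogPropPow (θ : A → Finset (List A)) (m r : ℕ) : Prop :=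
  ∀ (a : A) (x : ℤ → A), x ∈ inflCylPow θ m a → ∀ y ∈ Xtheta θ,
    (∀ t : ℤ, -(r : ℤ) ≤ t → t ≤ (r : ℤ) → x t = y t) → y ∈ inflCylPow θ m a

/-- The recognisability radius `κ(ϑ^m)`. -/
noncomputable def recogRadiusPow (θ : A → Finset (List A)) (m : ℕ) : ℕ :=
  sInf {r | RecogPropPow θ m r}

/-- The recognisability radius `κ(ϑ)`. -/
noncomputable def recogRadius (θ : A → Finset (List A)) : ℕ := recogRadiusPow θ 1

/-- The random word `ϑ_P^n(a)` is (a.s.) completely determined by `ϑ_P^{n+k}(a)`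
in the Markov chain. -/
def DeterminedBy (θ : A → Finset (List A)) (P : A → List A → ℝ)
    (a : A) (n k : ℕ) : Prop :=
  ∀ v₁ v₂ w : List A, v₁ ∈ realsIter θ n [a] → v₂ ∈ realsIter θ n [a] →
    0 < iterProb θ P n [a] v₁ * iterProb θ P k v₁ w →
      0 < iterProb θ P n [a] v₂ * iterProb θ P k v₂ w → v₁ = v₂

/-- The random words `ϑ_P^n(a)` and `ϑ_P^{n+k}(a)` are independent in the Markov chain. -/
def IndepSteps (θ : A → Finset (List A)) (P : A → List A → ℝ)
    (a : A) (n k : ℕ) : Prop :=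
  ∀ v w : List A,
    iterProb θ P n [a] v * iterProb θ P k v w =
      iterProb θ P n [a] v * iterProb θ P (n + k) [a] w

/-- The substitution matrix of a marginal (deterministic) substitution. -/
def marginalM (ρ : A → List A) : Matrix A A ℝ :=
  Matrix.of fun i j => ((ρ j).count i : ℝ)

/-- Geometric compatibility: a single positive left eigenvector with eigenvalue `λ > 1`
for all marginals. -/
def GeometricallyCompatible (θ : A → Finset (List A)) : Prop :=
  ∃ lam : ℝ, 1 < lam ∧ ∃ L : A → ℝ, (∀ a, 0 < L a) ∧
    ∀ ρ : A → List A, (∀ a, ρ a ∈ θ a) → Matrix.vecMul L (marginalM ρ) = lam • L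


set_option linter.unusedSectionVars false

lemma mem_reals_cons {θ : A → Finset (List A)} {a : A} {u w : List A} :
    w ∈ reals θ (a :: u) ↔ ∃ v ∈ θ a, ∃ w' ∈ reals θ u, v ++ w' = w := by
  simp [reals]

lemma mem_reals_append {θ : A → Finset (List A)} {u u' w : List A} :
    w ∈ reals θ (u ++ u') ↔ ∃ w₁ ∈ reals θ u, ∃ w₂ ∈ reals θ u', w₁ ++ w₂ = w := by
  induction u generalizing w with
  | nil => simp [reals]
  | cons a u ih =>
    simp only [List.cons_append, mem_reals_cons, ih]
    constructor
    · rintro ⟨v, hv, _, ⟨w₁, h₁, w₂, h₂, rfl⟩, rfl⟩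
      exact ⟨v ++ w₁, ⟨v, hv, w₁, h₁, rfl⟩, w₂, h₂, by simp⟩
    · rintro ⟨_, ⟨v, hv, w₁, h₁, rfl⟩, w₂, h₂, rfl⟩
      exact ⟨v, hv, w₁ ++ w₂, ⟨w₁, h₁, w₂, h₂, rfl⟩, by simp⟩

lemma length_of_mem_reals {θ : A → Finset (List A)} {ℓ : ℕ}
    (hlen : ∀ a, ∀ w ∈ θ a, w.length = ℓ) {u w : List A} (hw : w ∈ reals θ u) :
    w.length = ℓ * u.length := by
  induction u generalizing w with
  | nil => simp_all [reals]
  | cons a u ih =>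
    obtain ⟨v, hv, w', hw', rfl⟩ := mem_reals_cons.1 hw
    simp [hlen a v hv, ih hw']
    ring

lemma reals_nonempty {θ : A → Finset (List A)} (hne : ∀ a, (θ a).Nonempty) (u : List A) :
    (reals θ u).Nonempty := by
  induction u with
  | nil => simp [reals]
  | cons a u ih =>
    obtain ⟨w, hw⟩ := ih
    obtain ⟨v, hv⟩ := hne a
    exact ⟨v ++ w, mem_reals_cons.2 ⟨v, hv, w, hw, rfl⟩⟩

lemma card_reals {θ : A → Finset (List A)} {ℓ N : ℕ}
    (hlen : ∀ a, ∀ w ∈ θ a, w.length = ℓ) (hN : ∀ a, (θ a).card = N) (u : List A) :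
    (reals θ u).card = N ^ u.length := by
  induction u with
  | nil => simp [reals]
  | cons a u ih =>
    have h : reals θ (a :: u) = (θ a ×ˢ reals θ u).image fun p => p.1 ++ p.2 := by
      ext w
      simp only [mem_reals_cons, Finset.mem_image, Finset.mem_product, Prod.exists]
      aesop
    rw [h, Finset.card_image_of_injOn, Finset.card_product, hN, ih, List.length_cons, pow_succ']
    rintro ⟨v, w⟩ hp ⟨v', w'⟩ hp' heq
    simp only [Finset.coe_product, Set.mem_prod, Finset.mem_coe] at hp hp'
    obtain ⟨h₁, h₂⟩ := List.append_inj heq (by rw [hlen a v hp.1, hlen a v' hp'.1])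
    simp_all

/-- For constant length, membership in `ϑ(z)` is checked block by block. -/
lemma mem_reals_iff_blocks {θ : A → Finset (List A)} {ℓ : ℕ}
    (hlen : ∀ a, ∀ w ∈ θ a, w.length = ℓ) {z w : List A} :
    w ∈ reals θ z ↔ w.length = ℓ * z.length ∧
      ∀ (i : ℕ) (h : i < z.length), (w.drop (ℓ * i)).take ℓ ∈ θ z[i] := by
  induction z generalizing w with
  | nil => simp [reals]
  | cons a z ih =>
    rw [mem_reals_cons]
    constructor
    · rintro ⟨v, hv, w', hw', rfl⟩
      have hvl := hlen a v hv
      obtain ⟨h₁, h₂⟩ := ih.1 hw'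
      refine ⟨by simp [hvl, h₁]; ring, ?_⟩
      rintro (_ | i) hi
      · subst hvl
        simpa using hv
      · have h₃ : ℓ * (i + 1) = v.length + ℓ * i := by rw [hvl]; ring
        rw [h₃, ← List.drop_drop]
        simpa using h₂ i (by simpa using hi)
    · rintro ⟨h₁, h₂⟩
      have h₀ : w.take ℓ ∈ θ a := h₂ 0 (by simp)
      refine ⟨w.take ℓ, h₀, w.drop ℓ, ih.2 ⟨?_, ?_⟩, by simp⟩
      · rw [List.length_drop, h₁, List.length_cons, Nat.mul_succ]; omega
      · intro i hi
        have h₃ : (w.drop (ℓ * (i + 1))).take ℓ ∈ θ z[i] := h₂ (i + 1) (by simpa using hi)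
        rwa [Nat.mul_succ, Nat.add_comm, ← List.drop_drop] at h₃

lemma mem_realsIter_succ {θ : A → Finset (List A)} {n : ℕ} {u w : List A} :
    w ∈ realsIter θ (n + 1) u ↔ ∃ v ∈ realsIter θ n u, w ∈ reals θ v := by
  induction n generalizing u with
  | zero => simp [realsIter]
  | succ n ih =>
    rw [realsIter]
    simp only [Finset.mem_biUnion, ih]
    conv_rhs => rw [realsIter]
    simp only [Finset.mem_biUnion]
    aesop

lemma length_of_mem_realsIter {θ : A → Finset (List A)} {ℓ : ℕ}
    (hlen : ∀ a, ∀ w ∈ θ a, w.length = ℓ) {n : ℕ} {u w : List A}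
    (hw : w ∈ realsIter θ n u) : w.length = ℓ ^ n * u.length := by
  induction n generalizing w with
  | zero => simp_all [realsIter]
  | succ n ih =>
    obtain ⟨v, hv, hwv⟩ := mem_realsIter_succ.1 hw
    rw [length_of_mem_reals hlen hwv, ih hv]
    ring

lemma legal_of_mem_realsIter {θ : A → Finset (List A)} {k : ℕ} {a : A} {w : List A}
    (hw : w ∈ realsIter θ k [a]) : Legal θ w :=
  ⟨a, k, w, hw, List.infix_rfl⟩

lemma Legal.of_infix {θ : A → Finset (List A)} {u w : List A} (hw : Legal θ w)
    (h : u <:+: w) : Legal θ u := by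
  obtain ⟨a, k, w', hw', hi⟩ := hw
  exact ⟨a, k, w', hw', h.trans hi⟩

lemma Legal.of_mem_reals {θ : A → Finset (List A)} (hne : ∀ a, (θ a).Nonempty)
    {z w : List A} (hz : Legal θ z) (hw : w ∈ reals θ z) : Legal θ w := by
  obtain ⟨a, k, z', hz', s, t, rfl⟩ := hz
  obtain ⟨s', hs'⟩ := reals_nonempty hne s
  obtain ⟨t', ht'⟩ := reals_nonempty hne t
  refine ⟨a, k + 1, s' ++ w ++ t', mem_realsIter_succ.2 ⟨_, hz', ?_⟩, s', t', rfl⟩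
  exact mem_reals_append.2 ⟨_, mem_reals_append.2 ⟨_, hs', _, hw, rfl⟩, _, ht', rfl⟩

lemma mem_legalWords {θ : A → Finset (List A)} {n : ℕ} {v : List A} :
    v ∈ legalWords θ n ↔ v.length = n ∧ Legal θ v := by
  simp only [legalWords, allWords, Finset.mem_filter, Finset.mem_image, Finset.mem_univ,
    true_and, and_congr_left_iff]
  intro _
  constructor
  · rintro ⟨f, rfl⟩; simp
  · rintro rfl; exact ⟨v.get, List.ofFn_get v⟩

lemma occCount_eq_card (v w : List A) :
    occCount v w = ((Finset.range w.length).filter fun i => v <+: w.drop i).card := rfl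

lemma prefix_drop_iff {v w : List A} {i : ℕ} :
    v <+: w.drop i ↔ v = (w.drop i).take v.length := List.prefix_iff_eq_take

lemma infix_of_prefix_drop {v w : List A} {i : ℕ} (h : v <+: w.drop i) : v <:+: w :=
  h.isInfix.trans (List.drop_suffix i w).isInfix

lemma exists_prefix_drop_of_infix {v w : List A} (h : v <:+: w) : ∃ i, v <+: w.drop i := by
  obtain ⟨s, t, rfl⟩ := h
  exact ⟨s.length, t, by simp⟩

lemma length_add_le_of_prefix_drop {v w : List A} {i : ℕ} (hv : v ≠ [])
    (h : v <+: w.drop i) : i + v.length ≤ w.length := by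
  have h₁ := h.length_le
  have h₂ := List.length_pos_iff.2 hv
  rw [List.length_drop] at h₁
  omega

/-- A legal word with all its subwords of length `n ≥ 1` counted. -/
lemma sum_occCount_legalWords {θ : A → Finset (List A)} {w : List A} (hw : Legal θ w)
    {n : ℕ} (hn : 1 ≤ n) :
    ∑ v ∈ legalWords θ n, occCount v w = w.length + 1 - n := by
  simp only [occCount_eq_card, Finset.card_filter]
  rw [Finset.sum_comm]
  have h : ∀ i ∈ Finset.range w.length,
      (∑ v ∈ legalWords θ n, if v <+: w.drop i then 1 else 0) =
        if i < w.length + 1 - n then 1 else 0 := by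
    intro i _
    rw [← Finset.card_filter]
    split_ifs with hi
    · rw [Finset.card_eq_one]
      refine ⟨(w.drop i).take n, ?_⟩
      ext v
      simp only [Finset.mem_filter, mem_legalWords, Finset.mem_singleton]
      constructor
      · rintro ⟨⟨rfl, _⟩, h⟩
        exact prefix_drop_iff.1 h
      · rintro rfl
        refine ⟨⟨by simp; omega, hw.of_infix (infix_of_prefix_drop (List.take_prefix _ _))⟩,
          List.take_prefix _ _⟩
    · rw [Finset.card_eq_zero, Finset.filter_eq_empty_iff]
      intro v hv h
      obtain ⟨rfl, _⟩ := mem_legalWords.1 hv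
      have := length_add_le_of_prefix_drop (List.length_pos_iff.1 hn) h
      omega
  rw [Finset.sum_congr rfl h, ← Finset.card_filter]
  have : (Finset.range w.length).filter (fun i => i < w.length + 1 - n) =
      Finset.range (w.length + 1 - n) := by
    ext i; simp; omega
  rw [this, Finset.card_range]

lemma wordProb_of_mem_reals {θ : A → Finset (List A)} {P : A → List A → ℝ} {ℓ N : ℕ}
    (hlen : ∀ a, ∀ w ∈ θ a, w.length = ℓ) (hunif : ∀ a, ∀ s ∈ θ a, P a s = (N : ℝ)⁻¹)
    {u w : List A} (hw : w ∈ reals θ u) : wordProb θ P u w = ((N : ℝ) ^ u.length)⁻¹ := by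
  induction u generalizing w with
  | nil => simp_all [reals, wordProb]
  | cons a u ih =>
    obtain ⟨v, hv, w', hw', rfl⟩ := mem_reals_cons.1 hw
    rw [wordProb, Finset.sum_eq_single_of_mem v hv]
    · simp [hunif a v hv, ih hw', pow_succ, mul_comm]
    · intro v' hv' hne
      rw [if_neg, mul_zero]
      intro hp
      apply hne
      have h := List.prefix_iff_eq_take.1 hp
      rw [hlen a v' hv', ← hlen a v hv, List.take_left] at h
      exact h

/-- The expectation of `f (ϑ_P^k(u))`. -/
noncomputable def iterExp (θ : A → Finset (List A)) (P : A → List A → ℝ) (k : ℕ)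
    (f : List A → ℝ) (u : List A) : ℝ :=
  ∑ w ∈ realsIter θ k u, iterProb θ P k u w * f w

lemma iterProb_eq_zero {θ : A → Finset (List A)} {P : A → List A → ℝ} {k : ℕ}
    {u w : List A} (hw : w ∉ realsIter θ k u) : iterProb θ P k u w = 0 := by
  induction k generalizing u with
  | zero =>
    rw [iterProb, if_neg]
    rintro rfl
    simp [realsIter] at hw
  | succ k ih =>
    rw [iterProb]
    refine Finset.sum_eq_zero fun v hv => ?_
    rw [ih, mul_zero]
    intro h
    exact hw (by rw [realsIter]; exact Finset.mem_biUnion.2 ⟨v, hv, h⟩)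

lemma iterExp_succ (θ : A → Finset (List A)) (P : A → List A → ℝ) (k : ℕ)
    (f : List A → ℝ) (u : List A) :
    iterExp θ P (k + 1) f u = ∑ v ∈ reals θ u, wordProb θ P u v * iterExp θ P k f v := by
  simp only [iterExp, iterProb, Finset.sum_mul, Finset.mul_sum]
  rw [Finset.sum_comm]
  refine Finset.sum_congr rfl fun v hv => ?_
  have hsub : realsIter θ k v ⊆ realsIter θ (k + 1) u := by
    intro w hw
    rw [realsIter]
    exact Finset.mem_biUnion.2 ⟨v, hv, hw⟩
  rw [← Finset.sum_subset hsub]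
  · exact Finset.sum_congr rfl fun w _ => by ring
  · intro w _ hw
    rw [iterProb_eq_zero hw]
    ring

lemma iterExp_succ_last (θ : A → Finset (List A)) (P : A → List A → ℝ) (k : ℕ)
    (f : List A → ℝ) (u : List A) :
    iterExp θ P (k + 1) f u =
      iterExp θ P k (fun z => ∑ w ∈ reals θ z, wordProb θ P z w * f w) u := by
  induction k generalizing u with
  | zero => rw [iterExp_succ]; simp [iterExp, realsIter, iterProb]
  | succ k ih =>
    rw [iterExp_succ, iterExp_succ _ _ k]
    exact Finset.sum_congr rfl fun v _ => by rw [ih]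

lemma iterProb_nonneg {θ : A → Finset (List A)} {P : A → List A → ℝ} {ℓ N : ℕ}
    (hlen : ∀ a, ∀ w ∈ θ a, w.length = ℓ) (hunif : ∀ a, ∀ s ∈ θ a, P a s = (N : ℝ)⁻¹)
    (k : ℕ) (u w : List A) : 0 ≤ iterProb θ P k u w := by
  induction k generalizing u with
  | zero => rw [iterProb]; split_ifs <;> simp
  | succ k ih =>
    rw [iterProb]
    refine Finset.sum_nonneg fun v hv => mul_nonneg ?_ (ih v)
    rw [wordProb_of_mem_reals hlen hunif hv]
    positivity

lemma iterExp_one {θ : A → Finset (List A)} {P : A → List A → ℝ} {ℓ N : ℕ}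
    (hlen : ∀ a, ∀ w ∈ θ a, w.length = ℓ) (hN : ∀ a, (θ a).card = N) (hN0 : N ≠ 0)
    (hunif : ∀ a, ∀ s ∈ θ a, P a s = (N : ℝ)⁻¹) (k : ℕ) (u : List A) :
    iterExp θ P k (fun _ => 1) u = 1 := by
  induction k generalizing u with
  | zero => simp [iterExp, realsIter, iterProb]
  | succ k ih =>
    rw [iterExp_succ, Finset.sum_congr rfl fun v hv => by
      rw [ih, wordProb_of_mem_reals hlen hunif hv]]
    rw [Finset.sum_const, card_reals hlen hN]
    have : (N : ℝ) ≠ 0 := by exact_mod_cast hN0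
    simp [this]

lemma iterExp_congr {θ : A → Finset (List A)} {P : A → List A → ℝ} {k : ℕ}
    {f g : List A → ℝ} {u : List A} (h : ∀ w ∈ realsIter θ k u, f w = g w) :
    iterExp θ P k f u = iterExp θ P k g u :=
  Finset.sum_congr rfl fun w hw => by rw [h w hw]

lemma iterExp_const {θ : A → Finset (List A)} {P : A → List A → ℝ} {ℓ N : ℕ}
    (hlen : ∀ a, ∀ w ∈ θ a, w.length = ℓ) (hN : ∀ a, (θ a).card = N) (hN0 : N ≠ 0)
    (hunif : ∀ a, ∀ s ∈ θ a, P a s = (N : ℝ)⁻¹) (k : ℕ) (u : List A) (c : ℝ) :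
    iterExp θ P k (fun _ => c) u = c := by
  have h := iterExp_one hlen hN hN0 hunif k u
  simp only [iterExp, mul_one] at h ⊢
  rw [← Finset.sum_mul, h, one_mul]

lemma expLen_eq {θ : A → Finset (List A)} {P : A → List A → ℝ} {ℓ N : ℕ}
    (hlen : ∀ a, ∀ w ∈ θ a, w.length = ℓ) (hN : ∀ a, (θ a).card = N) (hN0 : N ≠ 0)
    (hunif : ∀ a, ∀ s ∈ θ a, P a s = (N : ℝ)⁻¹) (k : ℕ) (a : A) :
    expLen θ P k a = (ℓ : ℝ) ^ k := by
  rw [← iterExp_const hlen hN hN0 hunif k [a] ((ℓ : ℝ) ^ k)]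
  refine iterExp_congr (f := fun w => (w.length : ℝ)) fun w hw => ?_
  rw [length_of_mem_realsIter hlen hw]
  simp

/-- The expected frequencies of the legal words of length `n ≥ 1` sum to one. -/
lemma sum_freq_eq_one {θ : A → Finset (List A)} {P : A → List A → ℝ} {ℓ N : ℕ} (hℓ : 2 ≤ ℓ)
    (hlen : ∀ a, ∀ w ∈ θ a, w.length = ℓ) (hN : ∀ a, (θ a).card = N) (hN0 : N ≠ 0)
    (hunif : ∀ a, ∀ s ∈ θ a, P a s = (N : ℝ)⁻¹) {a : A} {F : List A → ℝ}
    (hF : ∀ v, Legal θ v →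
      Tendsto (fun k => expCount θ P k a v / expLen θ P k a) atTop (nhds (F v)))
    {n : ℕ} (hn : 1 ≤ n) : ∑ v ∈ legalWords θ n, F v = 1 := by
  have h₁ : Tendsto (fun k => ∑ v ∈ legalWords θ n, expCount θ P k a v / expLen θ P k a)
      atTop (nhds (∑ v ∈ legalWords θ n, F v)) :=
    tendsto_finsetSum _ fun v hv => hF v (mem_legalWords.1 hv).2
  have hpow : Tendsto (fun k : ℕ => (ℓ : ℝ) ^ k) atTop atTop :=
    tendsto_pow_atTop_atTop_of_one_lt (by exact_mod_cast hℓ)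
  refine tendsto_nhds_unique h₁ ?_
  have h₂ : Tendsto (fun k : ℕ => 1 + (1 - (n : ℝ)) / (ℓ : ℝ) ^ k) atTop (nhds (1 + 0)) :=
    tendsto_const_nhds.add (tendsto_const_nhds.div_atTop hpow)
  rw [add_zero] at h₂
  refine h₂.congr' ?_
  filter_upwards [hpow.eventually_ge_atTop (n : ℝ)] with k hk
  have hpos : (0 : ℝ) < (ℓ : ℝ) ^ k := by positivity
  rw [← Finset.sum_div, expLen_eq hlen hN hN0 hunif]
  have h₃ : ∑ v ∈ legalWords θ n, expCount θ P k a v = (ℓ : ℝ) ^ k + 1 - n := by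
    rw [← iterExp_const hlen hN hN0 hunif k [a] ((ℓ : ℝ) ^ k + 1 - n)]
    simp only [expCount]
    rw [Finset.sum_comm]
    refine Finset.sum_congr rfl fun w hw => ?_
    have hk' : n ≤ ℓ ^ k := by exact_mod_cast hk
    rw [← Finset.mul_sum, ← Nat.cast_sum,
      sum_occCount_legalWords (legal_of_mem_realsIter hw) hn, length_of_mem_realsIter hlen hw,
      Nat.cast_sub (by simp; omega)]
    simp
  rw [h₃]
  field_simp
  ring

lemma window_eq_map (x : ℤ → A) (m : ℤ) (n : ℕ) :
    window x m n = (List.range n).map fun t : ℕ => x (m + (t : ℤ)) := by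
  simp [window, ← List.map_eq_flatMap]

@[simp] lemma length_window (x : ℤ → A) (m : ℤ) (n : ℕ) : (window x m n).length = n := by
  simp [window_eq_map]

@[simp] lemma getElem_window (x : ℤ → A) (m : ℤ) (n t : ℕ) (h : t < (window x m n).length) :
    (window x m n)[t] = x (m + t) := by
  simp [window_eq_map]

lemma take_drop_window (x : ℤ → A) (m : ℤ) {n i k : ℕ} (h : i + k ≤ n) :
    ((window x m n).drop i).take k = window x (m + i) k := by
  refine List.ext_getElem (by simp; omega) fun t h₁ h₂ => ?_
  simp [add_assoc]

lemma window_infix (x : ℤ → A) {m m' : ℤ} {n n' : ℕ} (h₁ : m' ≤ m)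
    (h₂ : m + n ≤ m' + n') : window x m n <:+: window x m' n' := by
  obtain ⟨i, rfl⟩ : ∃ i : ℕ, m = m' + i := ⟨(m - m').toNat, by omega⟩
  rw [← take_drop_window x m' (show i + n ≤ n' by omega)]
  exact infix_of_prefix_drop (List.take_prefix _ _)

/-- `x` is decomposed, on the `2r+1` blocks around the origin, into inflation words of the
letters of `y`, the block of `y 0` starting at `-k`. -/
def IsBlockDecomp (θ : A → Finset (List A)) (ℓ r : ℕ) (x y : ℤ → A) (k : ℕ) : Prop :=
  Legal θ (window y (-r) (2 * r + 1)) ∧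
    ∀ i : ℤ, -r ≤ i → i ≤ r → window x (ℓ * i - k) ℓ ∈ θ (y i)

lemma IsBlockDecomp.mono {θ : A → Finset (List A)} {ℓ r s k : ℕ} {x y : ℤ → A}
    (h : IsBlockDecomp θ ℓ s x y k) (hrs : r ≤ s) : IsBlockDecomp θ ℓ r x y k :=
  ⟨h.1.of_infix (window_infix y (by omega) (by push_cast; omega)),
    fun i h₁ h₂ => h.2 i (by omega) (by omega)⟩

lemma isClosed_window_mem [TopologicalSpace A] [DiscreteTopology A] (m : ℤ) (n : ℕ)
    (S : Set (List A)) : IsClosed {x : ℤ → A | window x m n ∈ S} := by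
  have hc : Continuous fun (x : ℤ → A) (t : Fin n) => x (m + (t : ℕ)) := by fun_prop
  have h : ∀ x : ℤ → A, window x m n = List.ofFn fun t : Fin n => x (m + (t : ℕ)) := by
    intro x
    refine List.ext_getElem (by simp) fun t h₁ h₂ => by simp
  simp only [h]
  exact (isClosed_discrete {f : Fin n → A | List.ofFn f ∈ S}).preimage hc

lemma isClosed_isBlockDecomp [TopologicalSpace A] [DiscreteTopology A]
    (θ : A → Finset (List A)) (ℓ r k : ℕ) :
    IsClosed {p : (ℤ → A) × (ℤ → A) | IsBlockDecomp θ ℓ r p.1 p.2 k} := by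
  simp only [IsBlockDecomp, Set.ofPred_and, Set.ofPred_forall]
  refine ((isClosed_window_mem _ _ {u | Legal θ u}).preimage continuous_snd).inter ?_
  refine isClosed_iInter fun i => isClosed_iInter fun _ => isClosed_iInter fun _ => ?_
  have h : {p : (ℤ → A) × (ℤ → A) | window p.1 (ℓ * i - k) ℓ ∈ θ (p.2 i)} =
      ⋃ a : A, {p | window p.1 (ℓ * i - k) ℓ ∈ θ a} ∩ {p | p.2 i = a} := by
    ext p; simp
  rw [h]
  refine isClosed_iUnion_of_finite fun a => IsClosed.inter ?_ ?_
  · exact (isClosed_window_mem _ _ (θ a : Set (List A))).preimage continuous_fst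
  · have hc : Continuous fun p : (ℤ → A) × (ℤ → A) => p.2 i := by fun_prop
    exact isClosed_eq hc continuous_const

lemma window_mem_reals {θ : A → Finset (List A)} {ℓ : ℕ}
    (hlen : ∀ a, ∀ w ∈ θ a, w.length = ℓ) {x y : ℤ → A} {k : ℕ} {m : ℤ} {n : ℕ}
    (h : ∀ i, window x (ℓ * i - k) ℓ ∈ θ (y i)) :
    window x (ℓ * m - k) (ℓ * n) ∈ reals θ (window y m n) := by
  refine (mem_reals_iff_blocks hlen).2 ⟨by simp, fun i hi => ?_⟩
  rw [length_window] at hi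
  rw [take_drop_window _ _ (by rw [← Nat.mul_succ]; exact Nat.mul_le_mul_left _ hi),
    getElem_window]
  convert h (m + i) using 2
  push_cast
  ring

lemma maxLen_eq {θ : A → Finset (List A)} {ℓ : ℕ} (hne : ∀ a, (θ a).Nonempty)
    (hlen : ∀ a, ∀ w ∈ θ a, w.length = ℓ) (a : A) : maxLen θ a = ℓ := by
  rw [maxLen, Finset.sup_congr rfl (hlen a), Finset.sup_const (hne a)]

/-- Uniqueness of two-sided decompositions. -/
lemma eq_of_forall_isBlockDecomp {θ : A → Finset (List A)} {ℓ : ℕ} (hℓ : 2 ≤ ℓ)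
    (hne : ∀ a, (θ a).Nonempty) (hlen : ∀ a, ∀ w ∈ θ a, w.length = ℓ)
    (hrec : Recognisable θ) {x y y' : ℤ → A} {k k' : ℕ} (hk : k < ℓ) (hk' : k' < ℓ)
    (h : ∀ r, IsBlockDecomp θ ℓ r x y k) (h' : ∀ r, IsBlockDecomp θ ℓ r x y' k') :
    y = y' ∧ k = k' := by
  have hX : ∀ {y : ℤ → A} {k : ℕ}, (∀ r, IsBlockDecomp θ ℓ r x y k) → y ∈ Xtheta θ := by
    intro y k h m n
    refine (h (m.natAbs + n)).1.of_infix (window_infix y ?_ ?_) <;> omega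
  have hblock : ∀ {y : ℤ → A} {k : ℕ}, (∀ r, IsBlockDecomp θ ℓ r x y k) →
      ∀ i, window x (ℓ * i - k) ℓ ∈ θ (y i) := fun h i =>
    (h i.natAbs).2 i (by omega) (by omega)
  have hsub : ∀ {y : ℤ → A} {k : ℕ}, (∀ r, IsBlockDecomp θ ℓ r x y k) →
      (fun i => x (i - (k : ℤ))) ∈ substSeq θ y := by
    intro y k h
    refine ⟨fun j => window x (ℓ * j - k) ℓ, hblock h, fun j => ℓ * j, by simp,
      fun j => by simp; ring, fun j t ht => ?_⟩
    simp only [List.get_eq_getElem, getElem_window]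
    congr 1
    ring
  have hx : x ∈ Xtheta θ := by
    intro m n
    have hw := window_mem_reals hlen (m := -(m.natAbs + n : ℕ))
      (n := 2 * (m.natAbs + n) + 1) (hblock h)
    refine ((hX h _ _).of_mem_reals hne hw).of_infix (window_infix x ?_ ?_)
    · push_cast
      nlinarith [neg_abs_le m, abs_nonneg m,
        mul_le_mul_of_nonneg_right (show (2 : ℤ) ≤ ℓ by exact_mod_cast hℓ)
          (show (0 : ℤ) ≤ |m| + n by positivity)]
    · push_cast
      nlinarith [le_abs_self m, abs_nonneg m]
  have h₃ := (hrec x hx).unique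
    (y₁ := (y, k)) (y₂ := (y', k')) ⟨hX h, by rwa [maxLen_eq hne hlen], hsub h⟩
    ⟨hX h', by rwa [maxLen_eq hne hlen], hsub h'⟩
  simpa using h₃

/-- Local recognisability, obtained from compactness. -/
lemma exists_local_recognisability {θ : A → Finset (List A)} {ℓ : ℕ} (hℓ : 2 ≤ ℓ)
    (hne : ∀ a, (θ a).Nonempty) (hlen : ∀ a, ∀ w ∈ θ a, w.length = ℓ)
    (hrec : Recognisable θ) :
    ∃ r : ℕ, ∀ (x y y' : ℤ → A) (k k' : ℕ), k < ℓ → k' < ℓ → IsBlockDecomp θ ℓ r x y k →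
      IsBlockDecomp θ ℓ r x y' k' → k = k' ∧ y 0 = y' 0 := by
  let _ : TopologicalSpace A := ⊥
  have : DiscreteTopology A := ⟨rfl⟩
  have key : ∀ k k' : Fin ℓ, ∃ r : ℕ, ∀ x y y' : ℤ → A, IsBlockDecomp θ ℓ r x y k →
      IsBlockDecomp θ ℓ r x y' k' → (k : ℕ) = k' ∧ y 0 = y' 0 := by
    intro k k'
    by_contra! hcon
    let K : ℕ → Set ((ℤ → A) × (ℤ → A) × (ℤ → A)) := fun r =>
      {p | IsBlockDecomp θ ℓ r p.1 p.2.1 k} ∩ {p | IsBlockDecomp θ ℓ r p.1 p.2.2 k'} ∩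
        {p | (k : ℕ) = k' → p.2.1 0 ≠ p.2.2 0}
    have hclosed : ∀ r, IsClosed (K r) := by
      intro r
      refine (IsClosed.inter ?_ ?_).inter ?_
      · exact (isClosed_isBlockDecomp θ ℓ r k).preimage
          (continuous_fst.prodMk (continuous_fst.comp continuous_snd))
      · exact (isClosed_isBlockDecomp θ ℓ r k').preimage
          (continuous_fst.prodMk (continuous_snd.comp continuous_snd))
      · have hc : Continuous fun p : (ℤ → A) × (ℤ → A) × (ℤ → A) => (p.2.1 0, p.2.2 0) := by
          fun_prop
        exact (isClosed_discrete {q : A × A | (k : ℕ) = k' → q.1 ≠ q.2}).preimage hc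
    obtain ⟨⟨x, y, y'⟩, hp⟩ :=
      IsCompact.nonempty_iInter_of_sequence_nonempty_isCompact_isClosed K
        (fun r p hp => ⟨⟨hp.1.1.mono r.le_succ, hp.1.2.mono r.le_succ⟩, hp.2⟩)
        (fun r => by
          obtain ⟨x, y, y', h₁, h₂, h₃⟩ := hcon r
          exact ⟨(x, y, y'), ⟨h₁, h₂⟩, h₃⟩)
        (hclosed 0).isCompact hclosed
    rw [Set.mem_iInter] at hp
    obtain ⟨h₁, h₂⟩ := eq_of_forall_isBlockDecomp hℓ hne hlen hrec k.2 k'.2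
      (fun r => (hp r).1.1) (fun r => (hp r).1.2)
    exact (hp 0).2 h₂ (congrFun h₁ 0)
  choose R hR using key
  refine ⟨Finset.univ.sup fun q : Fin ℓ × Fin ℓ => R q.1 q.2,
    fun x y y' k k' hk hk' h h' => ?_⟩
  have hle : R ⟨k, hk⟩ ⟨k', hk'⟩ ≤ Finset.univ.sup fun q : Fin ℓ × Fin ℓ => R q.1 q.2 :=
    Finset.le_sup (f := fun q : Fin ℓ × Fin ℓ => R q.1 q.2)
      (Finset.mem_univ (⟨k, hk⟩, ⟨k', hk'⟩))
  exact hR ⟨k, hk⟩ ⟨k', hk'⟩ x y y' (h.mono hle) (h'.mono hle)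

lemma window_getD (L : List A) (a₀ : A) {c m : ℤ} {n₀ n : ℕ} (h : c + m = n₀)
    (hL : n₀ + n ≤ L.length) :
    window (fun t => L.getD (c + t).toNat a₀) m n = (L.drop n₀).take n := by
  refine List.ext_getElem (by simp; omega) fun t h₁ h₂ => ?_
  rw [length_window] at h₁
  have h₃ : (c + (m + t)).toNat = n₀ + t := by omega
  simp only [getElem_window, List.getElem_take, List.getElem_drop]
  rw [h₃, List.getD_eq_getElem _ _ (by omega)]

lemma take_drop_of_prefix_drop {v w : List A} {p n₀ n : ℕ} (h : v <+: w.drop p)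
    (hn : n₀ + n ≤ v.length) : (v.drop n₀).take n = (w.drop (p + n₀)).take n := by
  obtain ⟨t, ht⟩ := h
  rw [← List.drop_drop, ← ht, List.drop_append_of_le_length (by omega),
    List.take_append_of_le_length (by simp; omega)]

/-- An occurrence of `v` in a realisation of `ϑ(z)` yields a block decomposition around every
position of `v` far enough from its ends. -/
lemma isBlockDecomp_of_occurrence {θ : A → Finset (List A)} {ℓ r : ℕ}
    (hlen : ∀ a, ∀ w ∈ θ a, w.length = ℓ) (a₀ : A) {z w v : List A} (hz : Legal θ z)
    (hw : w ∈ reals θ z) {p d q k : ℕ} (hv : v <+: w.drop p) (hv₀ : v ≠ [])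
    (hpd : p + d = ℓ * q + k) (hk : k < ℓ) (hd : ℓ * (r + 1) ≤ d)
    (hd' : d + ℓ * (r + 1) ≤ v.length) :
    IsBlockDecomp θ ℓ r (fun t => v.getD ((d : ℤ) + t).toNat a₀)
      (fun i => z.getD ((q : ℤ) + i).toNat a₀) k := by
  have hwl := length_of_mem_reals hlen hw
  have hpv := length_add_le_of_prefix_drop hv₀ hv
  have hq : r + 1 ≤ q := by
    have : ℓ * (r + 1) < ℓ * (q + 1) := by rw [Nat.mul_succ ℓ q]; omega
    have := lt_of_mul_lt_mul_left this (Nat.zero_le _)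
    omega
  have hq' : q + r + 1 ≤ z.length := by
    have : ℓ * (q + (r + 1)) ≤ ℓ * z.length := by rw [Nat.mul_add]; omega
    exact le_of_mul_le_mul_left this (by omega)
  refine ⟨?_, fun i hi hi' => ?_⟩
  · rw [window_getD z a₀ (n₀ := q - r) (by omega) (by omega)]
    exact hz.of_infix (infix_of_prefix_drop (List.take_prefix _ _))
  · obtain ⟨i', hqi⟩ : ∃ i' : ℕ, (q : ℤ) + i = i' := ⟨(q + i).toNat, by omega⟩
    have hlow : (ℓ : ℤ) * -r ≤ ℓ * i := mul_le_mul_of_nonneg_left hi (by positivity)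
    have hupp : (ℓ : ℤ) * i ≤ ℓ * r := mul_le_mul_of_nonneg_left hi' (by positivity)
    have hd₁ : (ℓ : ℤ) * r + ℓ ≤ d := by exact_mod_cast hd
    have hd₂ : (d : ℤ) + (ℓ * r + ℓ) ≤ v.length := by exact_mod_cast hd'
    have hpd' : (p : ℤ) + d = ℓ * q + k := by exact_mod_cast hpd
    obtain ⟨n₀, hn₀⟩ : ∃ n₀ : ℕ, (d : ℤ) + (ℓ * i - k) = n₀ :=
      ⟨((d : ℤ) + (ℓ * i - k)).toNat, by rw [Int.toNat_of_nonneg]; linarith⟩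
    have hn₁ : n₀ + ℓ ≤ v.length := by zify; linarith
    have hpn : p + n₀ = ℓ * i' := by
      zify
      rw [← hqi, mul_add]
      linarith
    rw [window_getD v a₀ hn₀ hn₁, take_drop_of_prefix_drop hv hn₁, hpn]
    have hiz : i' < z.length := by omega
    have hb := ((mem_reals_iff_blocks hlen).1 hw).2 i' hiz
    dsimp only
    rwa [hqi, Int.toNat_natCast, List.getD_eq_getElem _ _ hiz]

/-- A long word occurring in some inflation word determines the bulk of its preimage. -/
lemma exists_common_preimage {θ : A → Finset (List A)} {ℓ r : ℕ} (hℓ : 2 ≤ ℓ)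
    (hlen : ∀ a, ∀ w ∈ θ a, w.length = ℓ)
    (hr : ∀ (x y y' : ℤ → A) (k k' : ℕ), k < ℓ → k' < ℓ → IsBlockDecomp θ ℓ r x y k →
      IsBlockDecomp θ ℓ r x y' k' → k = k' ∧ y 0 = y' 0)
    {j : ℕ} (hj : 1 ≤ j) {v : List A} (hv : ℓ * (j + 2 * r + 3) ≤ v.length)
    {z₀ w₀ : List A} (hz₀ : Legal θ z₀) (hw₀ : w₀ ∈ reals θ z₀) {p₀ : ℕ}
    (hp₀ : v <+: w₀.drop p₀) :
    ∃ (u : List A) (d : ℕ), u.length = j ∧ Legal θ u ∧ d + ℓ * j ≤ v.length ∧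
      ∀ z w p, Legal θ z → w ∈ reals θ z → v <+: w.drop p →
        ∃ q, p + d = ℓ * q ∧ u <+: z.drop q := by
  have hℓ₀ : 0 < ℓ := by omega
  have hv₀ : v ≠ [] := by
    rintro rfl
    simp at hv
    omega
  obtain ⟨q₀, hq₁, hq₂⟩ : ∃ q₀, p₀ + ℓ * (r + 1) ≤ ℓ * q₀ ∧ ℓ * q₀ < p₀ + ℓ * (r + 2) := by
    refine ⟨(p₀ + ℓ - 1) / ℓ + (r + 1), ?_⟩
    have h₁ := Nat.div_add_mod (p₀ + ℓ - 1) ℓ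
    have h₂ := Nat.mod_lt (p₀ + ℓ - 1) hℓ₀
    have h₃ : ℓ * (r + 2) = ℓ * (r + 1) + ℓ := by ring
    have h₄ := Nat.mul_add ℓ ((p₀ + ℓ - 1) / ℓ) (r + 1)
    omega
  obtain ⟨d, hd⟩ : ∃ d, ℓ * q₀ = p₀ + d := ⟨ℓ * q₀ - p₀, by
    have : 0 ≤ ℓ * (r + 1) := Nat.zero_le _
    omega⟩
  have e₁ : ℓ * (r + 2) = ℓ * (r + 1) + ℓ := by ring
  have e₂ : ℓ * (j + 2 * r + 3) = ℓ * j + ℓ * (r + 1) + ℓ * (r + 1) + ℓ := by ring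
  have hdj : d + ℓ * j + ℓ * (r + 1) ≤ v.length := by omega
  have hzl : ∀ {z w : List A} {p q : ℕ}, w ∈ reals θ z → v <+: w.drop p → ℓ * q ≤ p + d →
      q + j ≤ z.length := by
    intro z w p q hw hp hq
    have h₁ := length_of_mem_reals hlen hw
    have h₂ := length_add_le_of_prefix_drop hv₀ hp
    have : ℓ * (q + j) ≤ ℓ * z.length := by rw [Nat.mul_add]; omega
    exact le_of_mul_le_mul_left this hℓ₀
  have hz₀l := hzl hw₀ hp₀ hd.le
  have hinf : (z₀.drop q₀).take j <:+: z₀ := infix_of_prefix_drop (List.take_prefix _ _)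
  refine ⟨(z₀.drop q₀).take j, d, by simp; omega, hz₀.of_infix hinf, by omega,
    fun z w p hz hw hp => ?_⟩
  have hdm := Nat.div_add_mod (p + d) ℓ
  have hmod := Nat.mod_lt (p + d) hℓ₀
  set q := (p + d) / ℓ with hq
  have hqz := hzl hw hp (show ℓ * q ≤ p + d by omega)
  have a₀ : A := v.head hv₀
  have key : ∀ i < j, (0 = (p + d) % ℓ) ∧ z₀.getD (q₀ + i) a₀ = z.getD (q + i) a₀ := by
    intro i hi
    have hij : ℓ * i + ℓ ≤ ℓ * j := by rw [← Nat.mul_succ]; exact Nat.mul_le_mul_left _ hi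
    have h := hr _ _ _ 0 ((p + d) % ℓ) hℓ₀ hmod
      (isBlockDecomp_of_occurrence hlen a₀ hz₀ hw₀ (d := d + ℓ * i) (q := q₀ + i) hp₀ hv₀
        (by rw [Nat.mul_add]; omega) hℓ₀ (by omega) (by omega))
      (isBlockDecomp_of_occurrence hlen a₀ hz hw (d := d + ℓ * i) (q := q + i) hp hv₀
        (by rw [Nat.mul_add]; omega) hmod (by omega) (by omega))
    simpa only [add_zero, Int.toNat_natCast] using h
  refine ⟨q, by have := (key 0 hj).1; omega, ?_⟩
  rw [List.prefix_iff_eq_take]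
  refine List.ext_getElem (by simp; omega) fun i h₁ h₂ => ?_
  have hi : i < j := by
    rw [List.length_take] at h₁
    omega
  have h := (key i hi).2
  rw [List.getD_eq_getElem _ _ (by omega), List.getD_eq_getElem _ _ (by omega)] at h
  simpa using h

lemma take_drop_mem_reals {θ : A → Finset (List A)} {ℓ : ℕ}
    (hlen : ∀ a, ∀ w ∈ θ a, w.length = ℓ) {z w : List A} (hw : w ∈ reals θ z) {q : ℕ}
    (hq : q ≤ z.length) :
    w.take (ℓ * q) ∈ reals θ (z.take q) ∧ w.drop (ℓ * q) ∈ reals θ (z.drop q) := by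
  rw [← List.take_append_drop q z] at hw
  obtain ⟨w₁, h₁, w₂, h₂, rfl⟩ := mem_reals_append.1 hw
  have h₃ : w₁.length = ℓ * q := by
    rw [length_of_mem_reals hlen h₁, List.length_take, min_eq_left hq]
  rw [← h₃, List.take_left, List.drop_left]
  exact ⟨h₁, h₂⟩

/-- Prescribing `j` consecutive blocks leaves at most `N ^ (|z| - j)` realisations of `ϑ(z)`. -/
lemma card_filter_reals_le {θ : A → Finset (List A)} {ℓ N : ℕ}
    (hlen : ∀ a, ∀ w ∈ θ a, w.length = ℓ) (hN : ∀ a, (θ a).card = N) {z v : List A}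
    {p d q j : ℕ} (hpd : p + d = ℓ * q) (hdj : d + ℓ * j ≤ v.length)
    (hqj : q + j ≤ z.length) :
    ((reals θ z).filter fun w => v <+: w.drop p).card ≤ N ^ (z.length - j) := by
  have hcard : (reals θ (z.take q) ×ˢ reals θ (z.drop (q + j))).card =
      N ^ (z.length - j) := by
    rw [Finset.card_product, card_reals hlen hN, card_reals hlen hN, ← pow_add]
    congr 1
    simp
    omega
  rw [← hcard]
  refine Finset.card_le_card_of_injOn (fun w => (w.take (ℓ * q), w.drop (ℓ * (q + j)))) ?_ ?_
  · intro w hw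
    have hw' := (Finset.mem_filter.1 (Finset.mem_coe.1 hw)).1
    exact Finset.mem_coe.2 (Finset.mem_product.2
      ⟨(take_drop_mem_reals hlen hw' (by omega)).1, (take_drop_mem_reals hlen hw' hqj).2⟩)
  · have hsplit : ∀ w ∈ (reals θ z).filter fun w => v <+: w.drop p,
        w = w.take (ℓ * q) ++ ((v.drop d).take (ℓ * j) ++ w.drop (ℓ * (q + j))) := by
      intro w hw
      rw [take_drop_of_prefix_drop (Finset.mem_filter.1 hw).2 hdj, hpd, Nat.mul_add,
        ← List.drop_drop, List.take_append_drop, List.take_append_drop]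
    intro w hw w' hw' heq
    obtain ⟨h₁, h₂⟩ := Prod.mk.inj heq
    rw [hsplit w hw, hsplit w' hw', h₁, h₂]

lemma sum_occCount_reals_le {θ : A → Finset (List A)} {ℓ N j d : ℕ} (hℓ : 0 < ℓ)
    (hlen : ∀ a, ∀ w ∈ θ a, w.length = ℓ) (hN : ∀ a, (θ a).card = N) {z v u : List A}
    (hj : 1 ≤ j) (hu : u.length = j) (hdj : d + ℓ * j ≤ v.length)
    (h : ∀ w p, w ∈ reals θ z → v <+: w.drop p → ∃ q, p + d = ℓ * q ∧ u <+: z.drop q) :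
    ∑ w ∈ reals θ z, occCount v w ≤ N ^ (z.length - j) * occCount u z := by
  classical
  have hu₀ : u ≠ [] := List.length_pos_iff.1 (by omega)
  have h₁ : ∑ w ∈ reals θ z, occCount v w =
      ∑ p ∈ Finset.range (ℓ * z.length),
        ((reals θ z).filter fun w => v <+: w.drop p).card := by
    simp only [Finset.card_filter]
    rw [Finset.sum_comm]
    refine Finset.sum_congr rfl fun w hw => ?_
    rw [occCount_eq_card, Finset.card_filter, length_of_mem_reals hlen hw]
  have h₂ : ∀ p ∈ Finset.range (ℓ * z.length),
      ((reals θ z).filter fun w => v <+: w.drop p).card ≤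
        if ∃ q, p + d = ℓ * q ∧ u <+: z.drop q then N ^ (z.length - j) else 0 := by
    intro p _
    split_ifs with hq
    · obtain ⟨q, hq, hqu⟩ := hq
      have := length_add_le_of_prefix_drop hu₀ hqu
      exact card_filter_reals_le hlen hN hq hdj (by omega)
    · rw [Nat.le_zero, Finset.card_eq_zero, Finset.filter_eq_empty_iff]
      exact fun w hw hp => hq (h w p hw hp)
  rw [h₁]
  refine (Finset.sum_le_sum h₂).trans ?_
  rw [← Finset.sum_filter, Finset.sum_const, smul_eq_mul, mul_comm, occCount_eq_card]
  refine Nat.mul_le_mul_left _ (Finset.card_le_card_of_injOn (fun p => (p + d) / ℓ) ?_ ?_)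
  · intro p hp
    obtain ⟨q, hq, hqu⟩ := (Finset.mem_filter.1 (Finset.mem_coe.1 hp)).2
    have := length_add_le_of_prefix_drop hu₀ hqu
    have hpq : (p + d) / ℓ = q := by rw [hq, Nat.mul_div_cancel_left _ hℓ]
    change (p + d) / ℓ ∈ _
    rw [hpq]
    exact Finset.mem_coe.2 (Finset.mem_filter.2 ⟨Finset.mem_range.2 (by omega), hqu⟩)
  · intro p hp p' hp' heq
    obtain ⟨q, hq, -⟩ := (Finset.mem_filter.1 (Finset.mem_coe.1 hp)).2
    obtain ⟨q', hq', -⟩ := (Finset.mem_filter.1 (Finset.mem_coe.1 hp')).2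
    simp only [hq, hq', Nat.mul_div_cancel_left _ hℓ] at heq
    subst heq
    omega

/-- The one-step frequency estimate. -/
lemma freq_le {θ : A → Finset (List A)} {P : A → List A → ℝ} {ℓ N r j : ℕ} (hℓ : 2 ≤ ℓ)
    (hlen : ∀ a, ∀ w ∈ θ a, w.length = ℓ) (hN : ∀ a, (θ a).card = N) (hN0 : N ≠ 0)
    (hunif : ∀ a, ∀ s ∈ θ a, P a s = (N : ℝ)⁻¹)
    (hr : ∀ (x y y' : ℤ → A) (k k' : ℕ), k < ℓ → k' < ℓ → IsBlockDecomp θ ℓ r x y k →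
      IsBlockDecomp θ ℓ r x y' k' → k = k' ∧ y 0 = y' 0)
    {a : A} {F : List A → ℝ}
    (hF : ∀ v, Legal θ v →
      Tendsto (fun k => expCount θ P k a v / expLen θ P k a) atTop (nhds (F v)))
    {B : ℝ} (hB : 0 ≤ B) (hj : 1 ≤ j) (hFB : ∀ u, Legal θ u → u.length = j → F u ≤ B)
    {v : List A} (hv : ℓ * (j + 2 * r + 3) ≤ v.length) (hvL : Legal θ v) :
    F v ≤ ((N : ℝ) ^ j)⁻¹ * B := by
  have hNpos : (0 : ℝ) < N := by positivity
  have hstep : ∀ k, expCount θ P (k + 1) a v = iterExp θ P k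
      (fun z => ((N : ℝ) ^ z.length)⁻¹ * ((∑ w ∈ reals θ z, occCount v w : ℕ) : ℝ)) [a] := by
    intro k
    refine (iterExp_succ_last θ P k (fun w => (occCount v w : ℝ)) [a]).trans
      (iterExp_congr fun z _ => ?_)
    push_cast
    rw [Finset.mul_sum]
    exact Finset.sum_congr rfl fun w hw => by rw [wordProb_of_mem_reals hlen hunif hw]
  have hlim := (hF v hvL).comp (tendsto_add_atTop_nat 1)
  by_cases hocc : ∃ z w p, Legal θ z ∧ w ∈ reals θ z ∧ v <+: w.drop p
  · obtain ⟨z₀, w₀, p₀, hz₀, hw₀, hp₀⟩ := hocc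
    obtain ⟨u, d, hu, huL, hdj, hpre⟩ :=
      exists_common_preimage hℓ hlen hr hj hv hz₀ hw₀ hp₀
    refine le_trans ?_ (mul_le_mul_of_nonneg_left (hFB u huL hu) (by positivity))
    refine le_of_tendsto_of_tendsto' hlim ((hF u huL).const_mul _) fun k => ?_
    have hcount : expCount θ P (k + 1) a v ≤ ((N : ℝ) ^ j)⁻¹ * expCount θ P k a u := by
      rw [hstep, iterExp, expCount, Finset.mul_sum]
      refine Finset.sum_le_sum fun z hz => ?_
      rw [mul_left_comm ((N : ℝ) ^ j)⁻¹]
      refine mul_le_mul_of_nonneg_left ?_ (iterProb_nonneg hlen hunif k [a] z)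
      have h₁ := sum_occCount_reals_le (by omega) hlen hN hj hu hdj
        fun w p hw hp => hpre z w p (legal_of_mem_realsIter hz) hw hp
      have h₂ : (((∑ w ∈ reals θ z, occCount v w : ℕ)) : ℝ) ≤
          (N : ℝ) ^ (z.length - j) * occCount u z := by exact_mod_cast h₁
      by_cases hjz : j ≤ z.length
      · rw [inv_mul_le_iff₀ (by positivity)]
        refine h₂.trans (le_of_eq ?_)
        conv_rhs => rw [← Nat.sub_add_cancel hjz, pow_add]
        field_simp
      · have h₀ : occCount u z = 0 := by
          rw [occCount_eq_card, Finset.card_eq_zero, Finset.filter_eq_empty_iff]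
          intro i _ hi
          have := length_add_le_of_prefix_drop (List.length_pos_iff.1 (by omega)) hi
          omega
        rw [h₀, Nat.cast_zero, mul_zero] at h₂ ⊢
        exact mul_nonpos_of_nonneg_of_nonpos (by positivity) h₂
    have hnn : 0 ≤ ((N : ℝ) ^ j)⁻¹ * expCount θ P k a u :=
      mul_nonneg (by positivity) (Finset.sum_nonneg fun z _ =>
        mul_nonneg (iterProb_nonneg hlen hunif k [a] z) (Nat.cast_nonneg _))
    have hℓ' : (1 : ℝ) ≤ ℓ := by exact_mod_cast (by omega : 1 ≤ ℓ)
    simp only [Function.comp_apply, expLen_eq hlen hN hN0 hunif]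
    rw [← mul_div_assoc]
    exact div_le_div₀ hnn hcount (by positivity) (pow_le_pow_right₀ hℓ' (Nat.le_succ k))
  · have hzero : F v = 0 := by
      refine tendsto_nhds_unique hlim (tendsto_const_nhds.congr fun k => ?_)
      have : expCount θ P (k + 1) a v = 0 := by
        rw [hstep]
        refine Finset.sum_eq_zero fun z hz => ?_
        dsimp only
        rw [Finset.sum_eq_zero, Nat.cast_zero, mul_zero, mul_zero]
        intro w hw
        rw [occCount_eq_card, Finset.card_eq_zero, Finset.filter_eq_empty_iff]
        exact fun p _ hp => hocc ⟨z, w, p, legal_of_mem_realsIter hz, hw, hp⟩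
      simp [this]
    rw [hzero]
    positivity

/-- Every legal word of length `ℓ j + 1` is cut out of an inflation word of a legal word of
length `j + 1`. -/
lemma card_legalWords_le {θ : A → Finset (List A)} {ℓ N : ℕ} (hℓ : 0 < ℓ)
    (hlen : ∀ a, ∀ w ∈ θ a, w.length = ℓ) (hN : ∀ a, (θ a).card = N) {j : ℕ} (hj : 1 ≤ j) :
    (legalWords θ (ℓ * j + 1)).card ≤ ℓ * ((legalWords θ (j + 1)).card * N ^ (j + 1)) := by
  have hsub : legalWords θ (ℓ * j + 1) ⊆
      (Finset.range ℓ ×ˢ (legalWords θ (j + 1)).biUnion (reals θ)).image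
        fun q => (q.2.drop q.1).take (ℓ * j + 1) := by
    intro v hv
    obtain ⟨hvl, a, k, w, hw, hvw⟩ := mem_legalWords.1 hv
    have hℓj : 0 < ℓ * j := Nat.mul_pos hℓ hj
    obtain _ | k := k
    · have h₁ : w.length = 1 := by simpa using length_of_mem_realsIter hlen hw
      have h₂ := hvw.length_le
      omega
    obtain ⟨z, hz, hwz⟩ := mem_realsIter_succ.1 hw
    obtain ⟨p, hp⟩ := exists_prefix_drop_of_infix hvw
    have hpv := length_add_le_of_prefix_drop (List.length_pos_iff.1 (by omega)) hp
    have hwl := length_of_mem_reals hlen hwz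
    have hdm := Nat.div_add_mod p ℓ
    have hmod := Nat.mod_lt p hℓ
    have hqz : p / ℓ + j < z.length := by
      have : ℓ * (p / ℓ + j) < ℓ * z.length := by rw [Nat.mul_add]; omega
      exact lt_of_mul_lt_mul_left this (Nat.zero_le _)
    have hwq := (take_drop_mem_reals hlen (take_drop_mem_reals hlen hwz
      (q := p / ℓ) (by omega)).2 (q := j + 1) (by simp; omega)).1
    refine Finset.mem_image.2 ⟨(p % ℓ, (w.drop (ℓ * (p / ℓ))).take (ℓ * (j + 1))),
      Finset.mem_product.2 ⟨Finset.mem_range.2 hmod, Finset.mem_biUnion.2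
        ⟨_, mem_legalWords.2 ⟨by simp; omega, ?_⟩, hwq⟩⟩, ?_⟩
    · exact (legal_of_mem_realsIter hz).of_infix (infix_of_prefix_drop (List.take_prefix _ _))
    · have hmin : min (ℓ * j + 1) (ℓ * (j + 1) - p % ℓ) = ℓ * j + 1 := by
        rw [Nat.mul_succ]; omega
      simp only [List.drop_take, List.take_take, List.drop_drop]
      rw [hmin, hdm, ← hvl]
      exact (prefix_drop_iff.1 hp).symm
  refine (Finset.card_le_card hsub).trans (Finset.card_image_le.trans ?_)
  rw [Finset.card_product, Finset.card_range]
  refine Nat.mul_le_mul_left _ (Finset.card_biUnion_le.trans (le_of_eq ?_))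
  rw [Finset.sum_congr rfl fun z hz => by
    rw [card_reals hlen hN, (mem_legalWords.1 hz).1], Finset.sum_const, smul_eq_mul]

lemma card_legalWords_add_le (θ : A → Finset (List A)) (m n : ℕ) :
    (legalWords θ (m + n)).card ≤ (legalWords θ m).card * (legalWords θ n).card := by
  rw [← Finset.card_product]
  refine Finset.card_le_card_of_injOn (fun w => (w.take m, w.drop m)) ?_ ?_
  · intro w hw
    obtain ⟨hl, hL⟩ := mem_legalWords.1 (Finset.mem_coe.1 hw)
    exact Finset.mem_coe.2 (Finset.mem_product.2
      ⟨mem_legalWords.2 ⟨by simp; omega, hL.of_infix (List.take_prefix _ _).isInfix⟩,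
        mem_legalWords.2 ⟨by simp; omega, hL.of_infix (List.drop_suffix _ _).isInfix⟩⟩)
  · intro w _ w' _ heq
    obtain ⟨h₁, h₂⟩ := Prod.mk.inj heq
    rw [← List.take_append_drop m w, ← List.take_append_drop m w', h₁, h₂]

lemma subadditive_log_card_legalWords (θ : A → Finset (List A)) :
    Subadditive fun n => Real.log (legalWords θ n).card := by
  intro m n
  have h := card_legalWords_add_le θ m n
  dsimp only
  rcases Nat.eq_zero_or_pos (legalWords θ (m + n)).card with h₀ | h₀
  · rw [h₀, Nat.cast_zero, Real.log_zero]
    exact add_nonneg (Real.log_natCast_nonneg _) (Real.log_natCast_nonneg _)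
  · have hp := h₀.trans_le h
    have hm : (legalWords θ m).card ≠ 0 := (Nat.pos_of_mul_pos_right hp).ne'
    have hn : (legalWords θ n).card ≠ 0 := (Nat.pos_of_mul_pos_left hp).ne'
    rw [← Real.log_mul (by exact_mod_cast hm) (by exact_mod_cast hn)]
    exact Real.log_le_log (by exact_mod_cast h₀) (by exact_mod_cast h)

lemma tendsto_topEntropy (θ : A → Finset (List A)) :
    Tendsto (fun n : ℕ => Real.log (legalWords θ n).card / (n : ℝ)) atTop
      (nhds (topEntropy θ)) := by
  have h := (subadditive_log_card_legalWords θ).tendsto_lim ⟨0, by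
    rintro _ ⟨n, rfl⟩
    exact div_nonneg (Real.log_natCast_nonneg _) (Nat.cast_nonneg _)⟩
  rwa [topEntropy, h.limsup_eq]

lemma tendsto_index_div {n : ℕ → ℕ} (hn : ∀ i, 2 ^ i ≤ n i) :
    Tendsto (fun i : ℕ => (i : ℝ) / n i) atTop (nhds 0) := by
  refine squeeze_zero (fun i => by positivity) (fun i => ?_)
    (tendsto_self_mul_const_pow_of_lt_one (r := (1 / 2 : ℝ)) (by norm_num) (by norm_num))
  rw [one_div, inv_pow, ← div_eq_mul_inv]
  exact div_le_div_of_nonneg_left (by positivity) (by positivity) (by exact_mod_cast hn i)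

lemma tendsto_atTop_of_two_pow_le {n : ℕ → ℕ} (hn : ∀ i, 2 ^ i ≤ n i) :
    Tendsto n atTop atTop :=
  tendsto_atTop_mono (fun i => (Nat.lt_two_pow_self).le.trans (hn i)) tendsto_id

/-- Partial sums of an affine recursion with multiplier `ℓ`, relative to its last term. -/
lemma tendsto_sum_div {n : ℕ → ℕ} {ℓ : ℕ} (hℓ : 2 ≤ ℓ) {c : ℝ}
    (hrec : ∀ i, (n (i + 1) : ℝ) = ℓ * n i + c) (hn : ∀ i, 2 ^ i ≤ n i) :
    Tendsto (fun i => ((∑ t ∈ Finset.range i, n t : ℕ) : ℝ) / n i) atTop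
      (nhds (1 / ((ℓ : ℝ) - 1))) := by
  have hℓ' : (0 : ℝ) < (ℓ : ℝ) - 1 := by
    have : (2 : ℝ) ≤ ℓ := by exact_mod_cast hℓ
    linarith
  have hsum : ∀ i, ((∑ t ∈ Finset.range i, n t : ℕ) : ℝ) * ((ℓ : ℝ) - 1) =
      n i - n 0 - c * i := by
    intro i
    induction i with
    | zero => simp
    | succ i ih =>
      rw [Finset.sum_range_succ, Nat.cast_add, add_mul, ih, hrec]
      push_cast
      ring
  have h₀ : Tendsto (fun i => (n 0 : ℝ) / n i) atTop (nhds 0) :=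
    tendsto_const_nhds.div_atTop
      (tendsto_natCast_atTop_atTop.comp (tendsto_atTop_of_two_pow_le hn))
  have h₁ := ((tendsto_const_nhds (x := (1 : ℝ))).sub h₀).sub ((tendsto_index_div hn).const_mul c)
  have h₂ := h₁.div_const ((ℓ : ℝ) - 1)
  rw [mul_zero, sub_zero, sub_zero] at h₂
  refine h₂.congr fun i => ?_
  have hpos : (0 : ℝ) < n i := by exact_mod_cast (Nat.two_pow_pos i).trans_le (hn i)
  rw [div_eq_div_iff hℓ'.ne' hpos.ne', hsum]
  field_simp

lemma sum_negMulLog_le_log_card {ι : Type*} {s : Finset ι} {p : ι → ℝ}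
    (hp : ∀ i ∈ s, 0 ≤ p i) (hsum : ∑ i ∈ s, p i = 1) :
    ∑ i ∈ s, Real.negMulLog (p i) ≤ Real.log s.card := by
  have hs : 0 < s.card := Finset.card_pos.2 (Finset.nonempty_iff_ne_empty.2 fun h => by
    simp [h] at hsum)
  have hM : (0 : ℝ) < s.card := by exact_mod_cast hs
  have h : ∀ i ∈ s, Real.negMulLog (p i) ≤ (s.card : ℝ)⁻¹ - p i + p i * Real.log s.card := by
    intro i hi
    rcases (hp i hi).eq_or_lt with h₀ | h₀
    · rw [← h₀]
      simp
    · have h₁ := Real.log_le_sub_one_of_pos (x := ((s.card : ℝ) * p i)⁻¹) (by positivity)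
      rw [Real.log_inv, Real.log_mul hM.ne' h₀.ne'] at h₁
      have h₂ := mul_le_mul_of_nonneg_left h₁ h₀.le
      have h₃ : p i * (((s.card : ℝ) * p i)⁻¹ - 1) = (s.card : ℝ)⁻¹ - p i := by
        field_simp
      rw [Real.negMulLog]
      linarith
  refine (Finset.sum_le_sum h).trans (le_of_eq ?_)
  rw [Finset.sum_add_distrib, Finset.sum_sub_distrib, ← Finset.sum_mul, hsum, Finset.sum_const,
    nsmul_eq_mul, mul_inv_cancel₀ hM.ne']
  ring

lemma neg_log_le_sum_negMulLog {ι : Type*} {s : Finset ι} {p : ι → ℝ} {B : ℝ}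
    (hp : ∀ i ∈ s, 0 ≤ p i) (hB : ∀ i ∈ s, p i ≤ B) (hsum : ∑ i ∈ s, p i = 1) :
    -Real.log B ≤ ∑ i ∈ s, Real.negMulLog (p i) := by
  have h : ∀ i ∈ s, p i * -Real.log B ≤ Real.negMulLog (p i) := by
    intro i hi
    rcases (hp i hi).eq_or_lt with h₀ | h₀
    · simp [← h₀]
    · rw [Real.negMulLog, neg_mul, mul_neg, neg_le_neg_iff]
      exact mul_le_mul_of_nonneg_left (Real.log_le_log h₀ (hB i hi)) h₀.le
  have hle := Finset.sum_le_sum h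
  rwa [← Finset.sum_mul, hsum, one_mul] at hle

/-- The upper bound for the topological entropy; recognisability is not needed. -/
lemma topEntropy_le {θ : A → Finset (List A)} {ℓ N : ℕ} (hℓ : 2 ≤ ℓ)
    (hlen : ∀ a, ∀ w ∈ θ a, w.length = ℓ) (hN : ∀ a, (θ a).card = N) (hN0 : N ≠ 0)
    (hpos : ∀ n, 1 ≤ n → (legalWords θ n).card ≠ 0) :
    topEntropy θ ≤ Real.log N / ((ℓ : ℝ) - 1) := by
  let n : ℕ → ℕ := fun i => ℓ ^ i + 1
  have hn : ∀ i, 2 ^ i ≤ n i := fun i => (Nat.pow_le_pow_left hℓ i).trans (Nat.le_succ _)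
  have hbound : ∀ i, Real.log (legalWords θ (n i)).card ≤
      Real.log (legalWords θ (n 0)).card + i * Real.log ℓ +
        ((∑ t ∈ Finset.range i, n t : ℕ) : ℝ) * Real.log N := by
    intro i
    induction i with
    | zero => simp
    | succ i ih =>
      have h₁ := card_legalWords_le (by omega) hlen hN (j := ℓ ^ i)
        (Nat.one_le_pow _ _ (by omega))
      rw [← pow_succ'] at h₁
      have h₂ : (legalWords θ (n i)).card ≠ 0 := hpos _ (Nat.le_add_left _ _)
      have h₃ : Real.log (legalWords θ (n (i + 1))).card ≤
          Real.log ((ℓ : ℝ) * ((legalWords θ (n i)).card * (N : ℝ) ^ n i)) :=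
        Real.log_le_log (by exact_mod_cast Nat.pos_of_ne_zero (hpos _ (Nat.le_add_left _ _)))
          (by exact_mod_cast h₁)
      have hN' : (N : ℝ) ≠ 0 := by exact_mod_cast hN0
      have h₂' : ((legalWords θ (n i)).card : ℝ) ≠ 0 := by exact_mod_cast h₂
      have hℓ' : (ℓ : ℝ) ≠ 0 := by exact_mod_cast (by omega : ℓ ≠ 0)
      rw [Real.log_mul hℓ' (mul_ne_zero h₂' (pow_ne_zero _ hN')),
        Real.log_mul h₂' (pow_ne_zero _ hN'), Real.log_pow] at h₃
      rw [Finset.sum_range_succ]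
      push_cast
      push_cast at ih
      linarith
  have hS := tendsto_sum_div hℓ (n := n) (c := 1 - (ℓ : ℝ))
    (fun i => by simp only [n]; push_cast; ring) hn
  have h₀ : Tendsto (fun i => Real.log (legalWords θ (n 0)).card / n i) atTop (nhds 0) :=
    tendsto_const_nhds.div_atTop
      (tendsto_natCast_atTop_atTop.comp (tendsto_atTop_of_two_pow_le hn))
  have hlim := (h₀.add ((tendsto_index_div hn).mul_const (Real.log ℓ))).add
    (hS.mul_const (Real.log N))
  rw [zero_mul, zero_add, zero_add, one_div_mul_eq_div] at hlim
  refine le_of_tendsto_of_tendsto'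
    ((tendsto_topEntropy θ).comp (tendsto_atTop_of_two_pow_le hn)) hlim fun i => ?_
  refine (div_le_div_of_nonneg_right (hbound i) (Nat.cast_nonneg _)).trans (le_of_eq ?_)
  ring

/-- Frequencies of long words decay at rate `log N / (ℓ - 1)` along an affine recursion. -/
lemma exists_freq_decay {θ : A → Finset (List A)} {P : A → List A → ℝ} {ℓ N : ℕ} (hℓ : 2 ≤ ℓ)
    (hne : ∀ a, (θ a).Nonempty) (hlen : ∀ a, ∀ w ∈ θ a, w.length = ℓ)
    (hN : ∀ a, (θ a).card = N) (hN0 : N ≠ 0)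
    (hunif : ∀ a, ∀ s ∈ θ a, P a s = (N : ℝ)⁻¹) (hrec : Recognisable θ)
    {a : A} {F : List A → ℝ} (hF₁ : ∀ v, F v ≤ 1)
    (hF : ∀ v, Legal θ v →
      Tendsto (fun k => expCount θ P k a v / expLen θ P k a) atTop (nhds (F v))) :
    ∃ (n : ℕ → ℕ) (c : ℕ), (∀ i, n (i + 1) = ℓ * n i + c) ∧ (∀ i, 2 ^ i ≤ n i) ∧
      ∀ i, ∀ v, Legal θ v → v.length = n i →
        F v ≤ ((N : ℝ) ^ ∑ t ∈ Finset.range i, n t)⁻¹ := by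
  obtain ⟨r, hr⟩ := exists_local_recognisability hℓ hne hlen hrec
  let n : ℕ → ℕ := fun i => Nat.rec 1 (fun _ m => ℓ * m + ℓ * (2 * r + 3)) i
  have hnrec : ∀ i, n (i + 1) = ℓ * n i + ℓ * (2 * r + 3) := fun _ => rfl
  have hn : ∀ i, 2 ^ i ≤ n i := by
    intro i
    induction i with
    | zero => exact le_rfl
    | succ i ih =>
      rw [hnrec, pow_succ']
      exact (Nat.mul_le_mul hℓ ih).trans (Nat.le_add_right _ _)
  refine ⟨n, ℓ * (2 * r + 3), hnrec, hn, fun i => ?_⟩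
  induction i with
  | zero => intro v _ _; simpa using hF₁ v
  | succ i ih =>
    intro v hv hvl
    rw [Finset.sum_range_succ, pow_add, mul_inv, mul_comm]
    refine freq_le hℓ hlen hN hN0 hunif hr hF (by positivity)
      ((Nat.one_le_two_pow).trans (hn i)) ih (le_of_eq ?_) hv
    rw [hvl, hnrec]
    ring

theorem statement17 {A : Type*} [Fintype A] [DecidableEq A] [MeasurableSpace A]
    (θ : A → Finset (List A)) (P : A → List A → ℝ) (ℓ N : ℕ) (μ : Measure (ℤ → A))
    (hRS : IsRandomSubstitution θ P) (hprim : IsPrimitive θ P)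
    (hcl : ConstantLength θ ℓ) (hrec : Recognisable θ)
    (hN : ∀ a : A, (θ a).card = N)
    (hunif : ∀ a : A, ∀ s ∈ θ a, P a s = (N : ℝ)⁻¹)
    (hμ : IsFrequencyMeasure θ P μ) :
    topEntropy θ = Real.log N / ((ℓ : ℝ) - 1) ∧ measEntropy θ μ = topEntropy θ := by
  obtain ⟨hne, -⟩ := hRS
  obtain ⟨hℓ, hlen⟩ := hcl
  obtain ⟨hprob, -, -, hfreq⟩ := hμ
  obtain ⟨x⟩ : Nonempty (ℤ → A) := nonempty_of_isProbabilityMeasure μ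
  have hN0 : N ≠ 0 := by
    rw [← hN (x 0)]
    exact (Finset.card_pos.2 (hne (x 0))).ne'
  let F : List A → ℝ := fun v => (μ (cylinder v 0)).toReal
  have hF : ∀ v, Legal θ v → Tendsto (fun k => expCount θ P k (x 0) v / expLen θ P k (x 0))
      atTop (nhds (F v)) := fun v hv => hfreq v hv 0 (x 0)
  have hF₀ : ∀ v, 0 ≤ F v := fun v => ENNReal.toReal_nonneg
  have hF₁ : ∀ v, F v ≤ 1 := fun v => ENNReal.toReal_le_of_le_ofReal zero_le_one (by
    simpa using prob_le_one)
  have hsum : ∀ n, 1 ≤ n → ∑ v ∈ legalWords θ n, F v = 1 := fun n hn =>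
    sum_freq_eq_one hℓ hlen hN hN0 hunif hF hn
  have hcard : ∀ n, 1 ≤ n → (legalWords θ n).card ≠ 0 := by
    intro n hn h
    have h₁ := hsum n hn
    rw [Finset.card_eq_zero.1 h, Finset.sum_empty] at h₁
    exact zero_ne_one h₁
  have hupper := topEntropy_le hℓ hlen hN hN0 hcard
  have htop := tendsto_topEntropy θ
  have hle : (fun n : ℕ => entropySeq θ μ n / (n : ℝ)) ≤ᶠ[atTop]
      fun n : ℕ => Real.log (legalWords θ n).card / (n : ℝ) := by
    filter_upwards [eventually_ge_atTop 1] with n hn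
    exact div_le_div_of_nonneg_right
      (sum_negMulLog_le_log_card (fun v _ => hF₀ v) (hsum n hn)) (Nat.cast_nonneg _)
  have hbdd : IsBoundedUnder (· ≤ ·) atTop fun n : ℕ => entropySeq θ μ n / (n : ℝ) :=
    htop.isBoundedUnder_le.mono_le hle
  have hbdd' : IsBoundedUnder (· ≥ ·) atTop fun n : ℕ => entropySeq θ μ n / (n : ℝ) :=
    isBoundedUnder_of ⟨0, fun n => div_nonneg (Finset.sum_nonneg fun v _ =>
      Real.negMulLog_nonneg (hF₀ v) (hF₁ v)) (Nat.cast_nonneg _)⟩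
  have hmeas : measEntropy θ μ ≤ topEntropy θ :=
    limsup_le_limsup hle hbdd'.isCoboundedUnder_le htop.isBoundedUnder_le
  have hlower : Real.log N / ((ℓ : ℝ) - 1) ≤ measEntropy θ μ := by
    obtain ⟨n, c, hnrec, hn, hdecay⟩ :=
      exists_freq_decay hℓ hne hlen hN hN0 hunif hrec hF₁ hF
    have hS := (tendsto_sum_div hℓ (n := n) (c := (c : ℝ))
      (fun i => by rw [hnrec]; push_cast; ring) hn).mul_const (Real.log N)
    rw [one_div_mul_eq_div] at hS
    refine le_of_forall_lt_imp_le_of_dense fun b hb => ?_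
    refine le_limsup_of_frequently_le ?_ hbdd
    refine (tendsto_atTop_of_two_pow_le hn).frequently (Eventually.frequently ?_)
    filter_upwards [hS.eventually_const_lt hb] with i hi
    refine hi.le.trans ?_
    have h₁ := neg_log_le_sum_negMulLog (fun v _ => hF₀ v)
      (fun v hv => hdecay i v (mem_legalWords.1 hv).2 (mem_legalWords.1 hv).1)
      (hsum (n i) ((Nat.one_le_two_pow).trans (hn i)))
    rw [Real.log_inv, neg_neg, Real.log_pow] at h₁
    rw [div_mul_eq_mul_div]
    exact div_le_div_of_nonneg_right h₁ (Nat.cast_nonneg _)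
  exact ⟨le_antisymm hupper (hlower.trans hmeas), le_antisymm hmeas (hupper.trans hlower)⟩

end RandomSubstitutionTheory
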